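/- Let G_0 = G_0(n) be any sequence of graphs on the vertex set {1,…,n} and let G_rand ∼ G(n,p) for some p = p_n ∈ [0,1/2] satisfying (1+(log n)^{-40})/n ≤ p ≤ 100·(log n)/n. Then with high probability G = G_0 △ G_rand satisfies the following property: for every pair of distinct vertices u, v for which there exists some i with |S^{≤i}_G({u,v})| ≥ 100·(log n)/min{(np−1)², 1}, there is some j such that |S^{j}_G({u,v})| ≥ n/(4·(log n)^{140}). -/

import Mathlib

open MeasureTheory Filter

/-- Product of (independent) Bernoulli distributions on `ι → Bool`, with
success probability `q i` in coordinate `i`. -/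
noncomputable def bernoulliProduct (ι : Type*) [Fintype ι] [DecidableEq ι] (q : ι → ℝ) :
    Measure (ι → Bool) :=
  ∑ f : ι → Bool,
    (∏ i : ι, if f i then ENNReal.ofReal (q i) else ENNReal.ofReal (1 - q i)) •
      Measure.dirac f

/-- The Erdős–Rényi measure: each (potential) edge of the complete graph on `Fin n`
is present independently with probability `p`; encoded as a random `Sym2 (Fin n) → Bool`. -/
noncomputable def erdosRenyiMeasure (n : ℕ) (p : ℝ) : Measure (Sym2 (Fin n) → Bool) :=
  bernoulliProduct (Sym2 (Fin n)) fun _ => p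

/-- The graph on `Fin n` determined by an edge-indicator function. -/
def graphOfFlip {n : ℕ} (f : Sym2 (Fin n) → Bool) : SimpleGraph (Fin n) :=
  SimpleGraph.fromRel fun u v => f s(u, v) = true

/-- Symmetric difference of two graphs on the same vertex set. -/
def symmDiffG {V : Type*} (G₁ G₂ : SimpleGraph V) : SimpleGraph V :=
  SimpleGraph.fromRel fun u v => Xor' (G₁.Adj u v) (G₂.Adj u v)

/-- `crEquiv G c t u v` : vertices `u` and `v` get the same colour after `t` rounds of
colour refinement on `G`, starting from the colouring `c`. -/
def crEquiv {V : Type*} {Ω : Type*} (G : SimpleGraph V) (c : V → Ω) : ℕ → V → V → Prop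
  | 0, u, v => c u = c v
  | (t + 1), u, v => crEquiv G c t u v ∧ ∀ w : V,
      Nat.card {x : V // G.Adj u x ∧ crEquiv G c t x w} =
      Nat.card {x : V // G.Adj v x ∧ crEquiv G c t x w}

/-- `u` and `v` get the same colour in the stable colouring `R* c`. -/
def crStable {V : Type*} {Ω : Type*} (G : SimpleGraph V) (c : V → Ω) (u v : V) : Prop :=
  ∀ t, crEquiv G c t u v

/-- `u` and `v` get the same colour in the stable colouring `R* σ`
(colour refinement started from the trivial colouring). -/
def crStableTrivial {V : Type*} (G : SimpleGraph V) (u v : V) : Prop :=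
  crStable G (fun _ => (0 : ℕ)) u v

/-- Equality of the initial pair-colourings `φ_{G,c}` on two ordered pairs of vertices. -/
def wl2Init {V : Type*} {Ω : Type*} (G : SimpleGraph V) (c : V → Ω) (p q : V × V) : Prop :=
  (G.Adj p.1 p.2 ↔ G.Adj q.1 q.2) ∧ (p.1 = p.2 ↔ q.1 = q.2) ∧
    (p.1 = p.2 → q.1 = q.2 → c p.2 = c q.2)

/-- `wl2Equiv G c t p q` : the ordered pairs `p` and `q` get the same colour after `t` rounds of
the 2-dimensional Weisfeiler–Leman refinement on `G`, started from `φ_{G,c}`. -/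
def wl2Equiv {V : Type*} {Ω : Type*} (G : SimpleGraph V) (c : V → Ω) :
    ℕ → V × V → V × V → Prop
  | 0, p, q => wl2Init G c p q
  | (t + 1), p, q => wl2Equiv G c t p q ∧ ∀ r s : V × V,
      Nat.card {w : V // wl2Equiv G c t (p.1, w) r ∧ wl2Equiv G c t (w, p.2) s} =
      Nat.card {w : V // wl2Equiv G c t (q.1, w) r ∧ wl2Equiv G c t (w, q.2) s}

/-- `u` and `v` get the same colour in the vertex colouring `V* c` obtained from the stable
pair colouring of the 2-dimensional Weisfeiler–Leman algorithm started from `φ_{G,c}`. -/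
def wl2VertexEquiv {V : Type*} {Ω : Type*} (G : SimpleGraph V) (c : V → Ω) (u v : V) : Prop :=
  ∀ t, wl2Equiv G c t (u, u) (v, v)

/-- Given a colouring of `V(H)` encoded as the equivalence relation `r` ("has the same colour"),
`majority H r u v` says that at least half of the possible edges between the colour class of `u`
and the colour class of `v` are present in `H` (counting ordered pairs). -/
def majority {V : Type*} (H : SimpleGraph V) (r : V → V → Prop) (u v : V) : Prop :=
  Nat.card {p : V × V // p.1 ≠ p.2 ∧ r p.1 u ∧ r p.2 v} ≤
    2 * Nat.card {p : V × V // p.1 ≠ p.2 ∧ r p.1 u ∧ r p.2 v ∧ H.Adj p.1 p.2}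

/-- The disparity graph `D(H,c)`, for the colouring encoded by the relation `r`. -/
def disparity {V : Type*} (H : SimpleGraph V) (r : V → V → Prop) : SimpleGraph V :=
  SimpleGraph.fromRel fun u v => Xor' (H.Adj u v) (majority H r u v)

/-- The generalised disparity graph `D_L(H,c)` for a 0-1 matrix `L` on colours. -/
def gDisparity {V : Type*} {Ω : Type*} (H : SimpleGraph V) (c : V → Ω) (L : Ω → Ω → Bool) :
    SimpleGraph V :=
  SimpleGraph.fromRel fun u v => Xor' (H.Adj u v) (L (c u) (c v) = true)

/-- The vertex set of the connected component of `v` in `G`. -/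
def compSet {V : Type*} (G : SimpleGraph V) (v : V) : Set V := {u | G.Reachable v u}

/-- A colouring is equitable if any two vertices with the same colour have the same number of
neighbours in every colour class. -/
def IsEquitable {V : Type*} {Ω : Type*} (H : SimpleGraph V) (c : V → Ω) : Prop :=
  ∀ u v, c u = c v → ∀ a : Ω,
    Nat.card {x : V // H.Adj u x ∧ c x = a} = Nat.card {x : V // H.Adj v x ∧ c x = a}

/-- Vertex set of the `k`-core of `G`: the union of all vertex sets inducing minimum
degree at least `k`. -/
def kCore {V : Type*} (G : SimpleGraph V) (k : ℕ) : Set V :=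
  ⋃₀ {S : Set V | ∀ v ∈ S, k ≤ Nat.card {u : V // u ∈ S ∧ G.Adj v u}}

/-- `V_{2,3}(G)`: vertices of the 2-core of `G` having degree at least 3 in the 2-core. -/
def V23 {V : Type*} (G : SimpleGraph V) : Set V :=
  {v | v ∈ kCore G 2 ∧ 3 ≤ Nat.card {u : V // u ∈ kCore G 2 ∧ G.Adj v u}}

/-- The graph obtained from `G` by deleting all edges meeting `T`
(so that reachability in `avoidG G T` from `v ∉ T` is reachability in `G - T`). -/
def avoidG {V : Type*} (G : SimpleGraph V) (T : Set V) : SimpleGraph V :=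
  SimpleGraph.fromRel fun u v => G.Adj u v ∧ u ∉ T ∧ v ∉ T

/-- `V_{2,3}^{safe}(G)`: vertices `v ∈ V_{2,3}(G)` such that after deleting any set of at most
two other vertices, the component of `v` still contains at least 3 vertices of `V_{2,3}(G)`. -/
def V23safe {V : Type*} (G : SimpleGraph V) : Set V :=
  {v | v ∈ V23 G ∧ ∀ T : Finset V, T.card ≤ 2 → v ∉ T →
    3 ≤ Nat.card {w : V // w ∈ V23 G ∧ (avoidG G (T : Set V)).Reachable v w}}

open Classical in
/-- `Lmul G i u v w` is the multiplicity of the vertex `w` in the multiset `L^i_G(u,v)`. -/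
noncomputable def Lmul {V : Type*} [Fintype V] (G : SimpleGraph V) : ℕ → V → V → V → ℕ
  | 0, u, _, w => if w = u then 1 else 0
  | (i + 1), u, v, w =>
      (∑ x : V, if G.Adj w x then Lmul G i u v x else 0) -
        (∑ x : V, if G.Adj w x then Lmul G i v u x else 0)

/-- Union over `j < i` of the supports of `L^j_G(u,v)` and `L^j_G(v,u)`. -/
noncomputable def Sbelow {V : Type*} [Fintype V] (G : SimpleGraph V) (u v : V) (i : ℕ) :
    Set V :=
  {w | ∃ j < i, 0 < Lmul G j u v w ∨ 0 < Lmul G j v u w}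

/-- `S^{≤ i}_G({u,v})`. -/
noncomputable def Sle {V : Type*} [Fintype V] (G : SimpleGraph V) (u v : V) (i : ℕ) : Set V :=
  Sbelow G u v (i + 1)

/-- `S^{i}_G({u,v}) = S^{≤ i}_G({u,v}) \ S^{≤ i-1}_G({u,v})`. -/
noncomputable def Sat {V : Type*} [Fintype V] (G : SimpleGraph V) (u v : V) (i : ℕ) : Set V :=
  Sbelow G u v (i + 1) \ Sbelow G u v i

/-- Degree of a vertex (as `Nat.card` of the neighbour set, avoiding decidability issues). -/
noncomputable def ncDegree {V : Type*} (G : SimpleGraph V) (v : V) : ℕ :=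
  Nat.card {u : V // G.Adj v u}

/-- The random refinement of a colouring `c`: each vertex `v` with `f v = true` receives
a brand-new colour unique to itself. -/
def refineColor {V : Type*} {Ω : Type*} (c : V → Ω) (f : V → Bool) : V → Ω ⊕ V :=
  fun v => if f v then Sum.inr v else Sum.inl (c v)

/-- `D(H,c)` (for the colouring encoded by the relation `r`) is `s`-bounded: every
intersection of a colour class with a connected component of `D(H,c)` has at most
`s` elements. -/
def sBounded {V : Type*} (H : SimpleGraph V) (r : V → V → Prop) (s : ℕ) : Prop :=
  ∀ u v : V, Nat.card {w : V // r w u ∧ w ∈ compSet (disparity H r) v} ≤ s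

/-- The type of canonical colours after `t` rounds of colour refinement. -/
def CCol : ℕ → Type
  | 0 => Unit
  | (t + 1) => CCol t × Multiset (CCol t)

open Classical in
/-- The canonical colour of a vertex after `t` rounds of colour refinement. -/
noncomputable def canonColor {V : Type*} [Fintype V] (G : SimpleGraph V) :
    (t : ℕ) → V → CCol t
  | 0, _ => ()
  | (t + 1), v =>
      (canonColor G t v, (Finset.univ.filter fun w => G.Adj v w).val.map (canonColor G t))

/-- The modal probability `M(m,p)` of a `Binomial(m,p)` random variable. -/
noncomputable def modalProb (m : ℕ) (p : ℝ) : ℝ :=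
  (m.choose ⌊(m + 1 : ℝ) * p⌋₊ : ℝ) * p ^ ⌊(m + 1 : ℝ) * p⌋₊ *
    (1 - p) ^ (m - ⌊(m + 1 : ℝ) * p⌋₊)

section Bernoulli

variable {ι : Type*} [Fintype ι]

/-- The weight of a configuration under independent Bernoulli(`p`) coordinates. -/
noncomputable def bernWeight (p : ℝ) (f : ι → Bool) : ℝ := ∏ i, if f i then p else 1 - p

lemma bernWeight_nonneg {p : ℝ} (h0 : 0 ≤ p) (h1 : p ≤ 1) (f : ι → Bool) :
    0 ≤ bernWeight p f :=
  Finset.prod_nonneg fun i _ => by split_ifs <;> linarith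

variable [DecidableEq ι]

/-- The expectation of `F` under independent Bernoulli(`p`) coordinates. -/
noncomputable def bernExp (p : ℝ) (F : (ι → Bool) → ℝ) : ℝ := ∑ f, bernWeight p f * F f

open Classical in
/-- The configuration that is `f` on `A` and `g` off `A`. -/
noncomputable def splice {ι : Type*} (A : Set ι) (f g : ι → Bool) : ι → Bool :=
  fun i => if i ∈ A then f i else g i

lemma splice_of_mem {ι : Type*} {A : Set ι} {f g : ι → Bool} {i : ι} (h : i ∈ A) :
    splice A f g i = f i := if_pos h

lemma splice_of_notMem {ι : Type*} {A : Set ι} {f g : ι → Bool} {i : ι} (h : i ∉ A) :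
    splice A f g i = g i := if_neg h

lemma bernExp_mono {p : ℝ} (h0 : 0 ≤ p) (h1 : p ≤ 1) {F F' : (ι → Bool) → ℝ}
    (h : ∀ f, F f ≤ F' f) : bernExp p F ≤ bernExp p F' :=
  Finset.sum_le_sum fun f _ => mul_le_mul_of_nonneg_left (h f) (bernWeight_nonneg h0 h1 f)

lemma bernExp_add (p : ℝ) (F F' : (ι → Bool) → ℝ) :
    bernExp p (fun f => F f + F' f) = bernExp p F + bernExp p F' := by
  simp [bernExp, mul_add, Finset.sum_add_distrib]

lemma bernExp_sub (p : ℝ) (F F' : (ι → Bool) → ℝ) :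
    bernExp p (fun f => F f - F' f) = bernExp p F - bernExp p F' := by
  simp [bernExp, mul_sub, Finset.sum_sub_distrib]

lemma bernExp_const_mul (p c : ℝ) (F : (ι → Bool) → ℝ) :
    bernExp p (fun f => c * F f) = c * bernExp p F := by
  simp only [bernExp, Finset.mul_sum]
  exact Finset.sum_congr rfl fun f _ => by ring

lemma bernExp_mul_const (p c : ℝ) (F : (ι → Bool) → ℝ) :
    bernExp p (fun f => F f * c) = bernExp p F * c := by
  simp only [mul_comm _ c, bernExp_const_mul]

lemma bernExp_sum {α : Type*} (p : ℝ) (s : Finset α) (F : α → (ι → Bool) → ℝ) :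
    bernExp p (fun f => ∑ a ∈ s, F a f) = ∑ a ∈ s, bernExp p (F a) := by
  simp only [bernExp, Finset.mul_sum]
  exact Finset.sum_comm

lemma bernExp_prod_true (p : ℝ) (K : Finset ι) :
    bernExp p (fun f => ∏ k ∈ K, if f k then 1 else 0) = p ^ K.card := by
  classical
  have h : ∀ f : ι → Bool, bernWeight p f * (∏ k ∈ K, if f k then (1 : ℝ) else 0) =
      ∏ i, (if f i then p else 1 - p) * (if i ∈ K then (if f i then 1 else 0) else 1) := by
    intro f
    rw [Finset.prod_mul_distrib, Finset.prod_ite_mem, Finset.univ_inter, bernWeight]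
  have h2 := Finset.prod_univ_sum (fun _ : ι => (Finset.univ : Finset Bool))
    (fun i b => (if b then p else 1 - p) * (if i ∈ K then (if b then (1 : ℝ) else 0) else 1))
  rw [Fintype.piFinset_univ] at h2
  rw [bernExp, Finset.sum_congr rfl fun f _ => h f]
  convert h2.symm using 1
  simp

lemma bernExp_one (p : ℝ) : bernExp p (fun _ : ι → Bool => 1) = 1 := by
  simpa using bernExp_prod_true p (∅ : Finset ι)

lemma bernExp_const (p c : ℝ) : bernExp p (fun _ : ι → Bool => c) = c := by
  simpa [bernExp_one] using bernExp_mul_const p c (fun _ : ι → Bool => 1)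

/-- Resampling the coordinates outside an adaptively revealed set does not change expectations. -/
lemma bernExp_resample (p : ℝ) (R : (ι → Bool) → Set ι)
    (hR : ∀ f g, R (splice (R f) f g) = R f) (F : (ι → Bool) → ℝ) :
    bernExp p F = bernExp p (fun f => bernExp p (fun g => F (splice (R f) f g))) := by
  classical
  let Φ : (ι → Bool) × (ι → Bool) → (ι → Bool) × (ι → Bool) :=
    fun x => (splice (R x.1) x.1 x.2, splice (R x.1) x.2 x.1)
  have hΦ : Function.Involutive Φ := by
    rintro ⟨f, g⟩
    simp only [Φ, hR]
    ext i <;> by_cases hi : i ∈ R f <;> simp [splice, hi]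
  have hw : ∀ x, bernWeight p (Φ x).1 * bernWeight p (Φ x).2 =
      bernWeight p x.1 * bernWeight p x.2 := by
    rintro ⟨f, g⟩
    simp only [bernWeight, ← Finset.prod_mul_distrib, Φ]
    refine Finset.prod_congr rfl fun i _ => ?_
    by_cases hi : i ∈ R f
    · simp [splice, hi]
    · simp [splice, hi, mul_comm]
  have h1 : bernExp p (fun f => bernExp p (fun g => F (splice (R f) f g))) =
      ∑ x : (ι → Bool) × (ι → Bool), bernWeight p x.1 * bernWeight p x.2 * F (Φ x).1 := by
    rw [Fintype.sum_prod_type]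
    simp only [bernExp, Finset.mul_sum, mul_assoc, Φ]
  have h2 : bernExp p F =
      ∑ x : (ι → Bool) × (ι → Bool), bernWeight p x.1 * bernWeight p x.2 * F x.1 := by
    rw [Fintype.sum_prod_type]
    have h3 : bernExp p F = bernExp p (fun f => F f * bernExp p (fun _ : ι → Bool => 1)) := by
      simp [bernExp_one]
    rw [h3]
    simp only [bernExp, Finset.mul_sum]
    exact Finset.sum_congr rfl fun f _ => Finset.sum_congr rfl fun g _ => by ring
  rw [h1, h2, ← Equiv.sum_comp (hΦ.toPerm Φ)]
  exact Finset.sum_congr rfl fun x _ => by rw [Function.Involutive.coe_toPerm, hw]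

/-- Functions of disjoint sets of coordinates are independent. -/
lemma bernExp_mul_of_indep (p : ℝ) (A : Set ι) (F F' : (ι → Bool) → ℝ)
    (hF : ∀ f g, F (splice A f g) = F f) (hF' : ∀ f g, F' (splice A f g) = F' g) :
    bernExp p (fun f => F f * F' f) = bernExp p F * bernExp p F' := by
  rw [bernExp_resample p (fun _ => A) (fun _ _ => rfl)]
  simp only [hF, hF', bernExp_const_mul, bernExp_mul_const]

lemma bernExp_true (p : ℝ) (i : ι) : bernExp p (fun f => if f i then 1 else 0) = p := by
  simpa using bernExp_prod_true p {i}

lemma bernExp_true_mul_true (p : ℝ) {i j : ι} (hij : i ≠ j) :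
    bernExp p (fun f => (if f i then 1 else 0) * (if f j then 1 else 0)) = p ^ 2 := by
  classical
  simpa [Finset.prod_pair hij, Finset.card_pair hij] using bernExp_prod_true p {i, j}

/-- A signed sum of nonzero weights over randomly flipped bits is nonzero with
probability at least `s p (1 - s p)`, where `s` is the number of bits. -/
lemma bernExp_signedSum_ne_zero {p : ℝ} (h0 : 0 ≤ p) (h1 : p ≤ 1) {α : Type*} (X : Finset α)
    (e : α → ι) (he : Set.InjOn e X) (base : α → Prop) (c : ℤ) (d : α → ℤ)
    (hd : ∀ x ∈ X, d x ≠ 0) (hX : X.card * p ≤ 1) [DecidablePred base]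
    [∀ g : ι → Bool, ∀ x, Decidable (Xor (base x) (g (e x) = true))] :
    X.card * p * (1 - X.card * p) ≤ bernExp p (fun g =>
      if c + ∑ x ∈ X, (if Xor (base x) (g (e x) = true) then d x else 0) = 0 then 0 else 1) := by
  classical
  set N : (ι → Bool) → ℝ := fun g => ∑ x ∈ X, if g (e x) then 1 else 0 with hN
  have hNcard : ∀ g, N g = (X.filter fun x => g (e x) = true).card := by
    intro g; simp [hN]
  have hEN : bernExp p N = X.card * p := by
    rw [hN, bernExp_sum]
    simp [bernExp_true]
  have hENN : bernExp p (fun g => N g * N g) ≤ X.card * p + X.card * X.card * p ^ 2 := by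
    simp only [hN, Finset.sum_mul_sum, bernExp_sum]
    have h2 : ∀ x ∈ X, ∀ y ∈ X, bernExp p (fun g : ι → Bool =>
        (if g (e x) then 1 else 0) * (if g (e y) then 1 else 0)) ≤
          (if x = y then p else 0) + p ^ 2 := by
      intro x hx y hy
      by_cases hxy : x = y
      · subst hxy
        simp only [mul_ite, mul_one, mul_zero, if_true]
        have h3 := bernExp_true p (e x)
        have h4 : bernExp p (fun g : ι → Bool => if g (e x) then
          (if g (e x) then (1:ℝ) else 0) else 0) = p := by
          convert h3 using 3
          split_ifs <;> rfl
        rw [h4]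
        nlinarith
      · rw [bernExp_true_mul_true p fun h => hxy (he hx hy h), if_neg hxy]
        simp
    refine (Finset.sum_le_sum fun x hx => Finset.sum_le_sum fun y hy => h2 x hx y hy).trans ?_
    simp [Finset.sum_add_distrib, Finset.sum_ite_eq]
    nlinarith
  have hval : ∀ g : ι → Bool,
      c + ∑ x ∈ X, (if Xor (base x) (g (e x) = true) then d x else 0) =
      (c + ∑ x ∈ X, if base x then d x else 0) +
        ∑ x ∈ X.filter (fun x => g (e x) = true), (if base x then - d x else d x) := by
    intro g
    rw [add_assoc, Finset.sum_filter, ← Finset.sum_add_distrib]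
    congr 1
    refine Finset.sum_congr rfl fun x _ => ?_
    by_cases hb : base x <;> by_cases hg : g (e x) = true <;> simp [hb, hg, Xor]
  have hq0 : 0 ≤ X.card * p := by positivity
  by_cases hc : (c + ∑ x ∈ X, if base x then d x else 0) = 0
  · have hle : bernExp p (fun g => N g + N g - N g * N g) ≤ bernExp p (fun g =>
        if c + ∑ x ∈ X, (if Xor (base x) (g (e x) = true) then d x else 0) = 0
        then (0 : ℝ) else 1) := by
      refine bernExp_mono h0 h1 fun g => ?_
      rw [hval, hc, hNcard, zero_add]
      obtain h | h | h : (X.filter fun x => g (e x) = true).card = 0 ∨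
          (X.filter fun x => g (e x) = true).card = 1 ∨
          2 ≤ (X.filter fun x => g (e x) = true).card := by omega
      · rw [h]; split_ifs <;> norm_num
      · rw [h]
        obtain ⟨x, hx⟩ := Finset.card_eq_one.1 h
        have hxX : x ∈ X := by
          have : x ∈ X.filter fun x => g (e x) = true := by rw [hx]; simp
          exact (Finset.mem_filter.1 this).1
        rw [hx, Finset.sum_singleton, if_neg]
        · norm_num
        · split_ifs
          · simpa using hd x hxX
          · exact hd x hxX
      · have h' : (2 : ℝ) ≤ (X.filter fun x => g (e x) = true).card := by exact_mod_cast h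
        split_ifs <;> nlinarith
    rw [bernExp_sub, bernExp_add, hEN] at hle
    nlinarith
  · have hle : bernExp p (fun g => 1 - N g) ≤ bernExp p (fun g =>
        if c + ∑ x ∈ X, (if Xor (base x) (g (e x) = true) then d x else 0) = 0
        then (0 : ℝ) else 1) := by
      refine bernExp_mono h0 h1 fun g => ?_
      rw [hval, hNcard]
      obtain h | h : (X.filter fun x => g (e x) = true).card = 0 ∨
          1 ≤ (X.filter fun x => g (e x) = true).card := by omega
      · rw [h, Finset.card_eq_zero.1 h, Finset.sum_empty, add_zero, if_neg hc]
        simp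
      · have h' : (1 : ℝ) ≤ (X.filter fun x => g (e x) = true).card := by exact_mod_cast h
        split_ifs <;> linarith
    rw [bernExp_sub, bernExp_one, hEN] at hle
    nlinarith

end Bernoulli

section SignedWalk

variable {V : Type*} [Fintype V]

open Classical in
/-- The signed walk count `A ^ k (e_u - e_v)`, where `A` is the adjacency matrix of `G`. -/
noncomputable def signedWalk (G : SimpleGraph V) (u v : V) : ℕ → V → ℤ
  | 0, w => (if w = u then 1 else 0) - (if w = v then 1 else 0)
  | (k + 1), w => ∑ x : V, if G.Adj w x then signedWalk G u v k x else 0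

lemma Lmul_sub_Lmul (G : SimpleGraph V) (u v : V) (k : ℕ) (w : V) :
    (Lmul G k u v w : ℤ) - Lmul G k v u w = signedWalk G u v k w := by
  classical
  induction k generalizing w with
  | zero => simp only [Lmul, signedWalk]; push_cast; convert rfl
  | succ k ih =>
    have h : signedWalk G u v (k + 1) w =
        ((∑ x : V, if G.Adj w x then Lmul G k u v x else 0 : ℕ) : ℤ) -
        ((∑ x : V, if G.Adj w x then Lmul G k v u x else 0 : ℕ) : ℤ) := by
      push_cast
      rw [← Finset.sum_sub_distrib, signedWalk]
      refine Finset.sum_congr rfl fun x _ => ?_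
      rw [← ih]
      split_ifs <;> simp
    rw [h]
    simp only [Lmul]
    omega

lemma Lmul_eq_zero_or (G : SimpleGraph V) {u v : V} (huv : u ≠ v) (k : ℕ) (w : V) :
    Lmul G k u v w = 0 ∨ Lmul G k v u w = 0 := by
  cases k with
  | zero =>
    simp only [Lmul]
    by_cases h : w = u
    · exact Or.inr (if_neg fun h' => huv (h.symm.trans h'))
    · exact Or.inl (if_neg h)
  | succ k => simp only [Lmul]; omega

lemma mem_Sbelow_iff (G : SimpleGraph V) {u v : V} (huv : u ≠ v) (i : ℕ) (w : V) :
    w ∈ Sbelow G u v i ↔ ∃ j < i, signedWalk G u v j w ≠ 0 := by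
  refine exists_congr fun j => and_congr_right fun _ => ?_
  rw [← Lmul_sub_Lmul]
  have := Lmul_eq_zero_or G huv j w
  omega

lemma Sbelow_mono (G : SimpleGraph V) (u v : V) : Monotone (Sbelow G u v) :=
  fun _ _ hij _ ⟨k, hk, h⟩ => ⟨k, hk.trans_le hij, h⟩

lemma Sbelow_zero (G : SimpleGraph V) (u v : V) : Sbelow G u v 0 = ∅ := by
  ext w; simp [Sbelow]

lemma ncard_Sbelow_succ (G : SimpleGraph V) (u v : V) (i : ℕ) :
    (Sbelow G u v (i + 1)).ncard = (Sbelow G u v i).ncard + (Sat G u v i).ncard := by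
  rw [Sat, add_comm (Set.ncard _)]
  exact (Set.ncard_sdiff_add_ncard_of_subset (Sbelow_mono G u v i.le_succ) (Set.toFinite _)).symm

lemma mem_Sat_iff (G : SimpleGraph V) {u v : V} (huv : u ≠ v) (i : ℕ) (w : V) :
    w ∈ Sat G u v i ↔ w ∉ Sbelow G u v i ∧ signedWalk G u v i w ≠ 0 := by
  rw [Sat, Set.mem_sdiff, mem_Sbelow_iff G huv, mem_Sbelow_iff G huv]
  constructor
  · rintro ⟨⟨j, hj, h⟩, h'⟩
    obtain rfl | hji : j = i ∨ j < i := by omega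
    · exact ⟨h', h⟩
    · exact absurd ⟨j, hji, h⟩ h'
  · rintro ⟨hnew, h⟩
    exact ⟨⟨i, by omega, h⟩, hnew⟩

/-- The signed walk counts up to time `k` depend only on the edges meeting the vertices that were
active before time `k`. -/
lemma signedWalk_congr {G G' : SimpleGraph V} {u v : V} (huv : u ≠ v) {k : ℕ}
    (h : ∀ w x, x ∈ Sbelow G u v k → (G'.Adj w x ↔ G.Adj w x)) :
    ∀ j ≤ k, signedWalk G' u v j = signedWalk G u v j := by
  intro j
  induction j with
  | zero => intro _; rfl
  | succ j ih =>
    intro hj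
    ext w
    simp only [signedWalk]
    refine Finset.sum_congr rfl fun x _ => ?_
    rw [ih (by omega)]
    by_cases hx : signedWalk G u v j x = 0
    · simp [hx]
    · have hadj := h w x ((mem_Sbelow_iff G huv k x).2 ⟨j, hj, hx⟩)
      by_cases hb : G.Adj w x <;> simp [hadj, hb]

lemma Sbelow_congr {G G' : SimpleGraph V} {u v : V} (huv : u ≠ v) {k : ℕ}
    (h : ∀ w x, x ∈ Sbelow G u v k → (G'.Adj w x ↔ G.Adj w x)) {j : ℕ} (hj : j ≤ k + 1) :
    Sbelow G' u v j = Sbelow G u v j := by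
  ext w
  rw [mem_Sbelow_iff G huv, mem_Sbelow_iff G' huv]
  refine exists_congr fun i => and_congr_right fun hi => ?_
  rw [signedWalk_congr huv h i (by omega)]

lemma Sat_congr {G G' : SimpleGraph V} {u v : V} (huv : u ≠ v) {k : ℕ}
    (h : ∀ w x, x ∈ Sbelow G u v k → (G'.Adj w x ↔ G.Adj w x)) {j : ℕ} (hj : j ≤ k) :
    Sat G' u v j = Sat G u v j := by
  rw [Sat, Sat, Sbelow_congr huv h (by omega), Sbelow_congr huv h (by omega)]

end SignedWalk

section Exploration

variable {n : ℕ}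

/-- The randomly perturbed graph. -/
abbrev perturb (G₀ : SimpleGraph (Fin n)) (f : Sym2 (Fin n) → Bool) : SimpleGraph (Fin n) :=
  symmDiffG G₀ (graphOfFlip f)

lemma perturb_adj (G₀ : SimpleGraph (Fin n)) (f : Sym2 (Fin n) → Bool) (w x : Fin n) :
    (perturb G₀ f).Adj w x ↔ w ≠ x ∧ Xor (G₀.Adj w x) (f s(w, x) = true) := by
  simp only [perturb, symmDiffG, graphOfFlip, SimpleGraph.fromRel_adj, Sym2.eq_swap (a := x),
    G₀.adj_comm x w, or_self, Xor']
  refine and_congr_right fun h => ?_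
  simp [h, h.symm]

/-- The edges revealed when exploring up to time `k`. -/
def revealed (G₀ : SimpleGraph (Fin n)) (u v : Fin n) (k : ℕ) (f : Sym2 (Fin n) → Bool) :
    Set (Sym2 (Fin n)) :=
  {e | ∃ x ∈ e, x ∈ Sbelow (perturb G₀ f) u v k}

lemma perturb_splice_adj (G₀ : SimpleGraph (Fin n)) (u v : Fin n) (k : ℕ)
    (f g : Sym2 (Fin n) → Bool) (w x : Fin n) (hx : x ∈ Sbelow (perturb G₀ f) u v k) :
    (perturb G₀ (splice (revealed G₀ u v k f) f g)).Adj w x ↔ (perturb G₀ f).Adj w x := by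
  rw [perturb_adj, perturb_adj, splice_of_mem]
  exact ⟨x, Sym2.mem_mk_right w x, hx⟩

lemma revealed_splice (G₀ : SimpleGraph (Fin n)) {u v : Fin n} (huv : u ≠ v) (k : ℕ)
    (f g : Sym2 (Fin n) → Bool) :
    revealed G₀ u v k (splice (revealed G₀ u v k f) f g) = revealed G₀ u v k f := by
  conv_lhs => rw [revealed]
  rw [Sbelow_congr huv (perturb_splice_adj G₀ u v k f g) (by omega)]
  rfl

/-- Laplace transform bound for the number of newly discovered vertices, for an abstract
single step of the exploration. -/
lemma bernExp_prod_le {p a : ℝ} (h0 : 0 ≤ p) (h1 : p ≤ 1) (ha0 : 0 ≤ a) (ha1 : a ≤ 1)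
    (G₀ : SimpleGraph (Fin n)) (X W : Finset (Fin n)) (hXW : ∀ w ∈ W, w ∉ X)
    (hX : X.card * p ≤ 1) (c : Fin n → ℤ) (d : Fin n → ℤ) (hd : ∀ x ∈ X, d x ≠ 0)
    [DecidableRel G₀.Adj] :
    bernExp p (fun g : Sym2 (Fin n) → Bool => ∏ w ∈ W,
      if c w + ∑ x ∈ X, (if Xor (G₀.Adj w x) (g s(w, x) = true) then d x else 0) = 0
        then 1 else a) ≤
      Real.exp (-((1 - a) * (X.card * p * (1 - X.card * p)) * W.card)) := by
  classical
  induction W using Finset.induction_on with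
  | empty => simp [bernExp_one]
  | insert w W hw ih =>
    specialize ih fun w' hw' => hXW w' (Finset.mem_insert_of_mem hw')
    have hwX := hXW w (Finset.mem_insert_self _ _)
    simp only [Finset.prod_insert hw]
    rw [bernExp_mul_of_indep p {e | ∃ x ∈ X, e = s(w, x)}, Finset.card_insert_of_notMem hw]
    · have h3 := bernExp_signedSum_ne_zero h0 h1 X (fun x => s(w, x))
        (fun x _ y _ h => Sym2.congr_right.1 h) (fun x => G₀.Adj w x) (c w) d hd hX
      have h4 : bernExp p (fun g : Sym2 (Fin n) → Bool =>
          if c w + ∑ x ∈ X, (if Xor (G₀.Adj w x) (g s(w, x) = true) then d x else 0) = 0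
            then 1 else a) = 1 - (1 - a) * bernExp p (fun g : Sym2 (Fin n) → Bool =>
          if c w + ∑ x ∈ X, (if Xor (G₀.Adj w x) (g s(w, x) = true) then d x else 0) = 0
            then 0 else 1) := by
        rw [← bernExp_const_mul, eq_sub_iff_add_eq, ← bernExp_add]
        conv_rhs => rw [← bernExp_one (ι := Sym2 (Fin n)) p]
        congr 1
        ext g
        split_ifs <;> ring
      rw [h4]
      have h5 : 1 - (1 - a) * bernExp p (fun g : Sym2 (Fin n) → Bool =>
          if c w + ∑ x ∈ X, (if Xor (G₀.Adj w x) (g s(w, x) = true) then d x else 0) = 0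
            then 0 else 1) ≤ Real.exp (-((1 - a) * (X.card * p * (1 - X.card * p)))) := by
        refine le_trans ?_ (Real.add_one_le_exp _)
        nlinarith [mul_le_mul_of_nonneg_left h3 (sub_nonneg.2 ha1)]
      have h6 : 0 ≤ bernExp p (fun g : Sym2 (Fin n) → Bool => ∏ w ∈ W,
          if c w + ∑ x ∈ X, (if Xor (G₀.Adj w x) (g s(w, x) = true) then d x else 0) = 0
            then 1 else a) := by
        rw [← bernExp_const (ι := Sym2 (Fin n)) p 0]
        refine bernExp_mono h0 h1 fun g => Finset.prod_nonneg fun w _ => ?_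
        split_ifs <;> linarith
      refine (mul_le_mul h5 ih h6 (Real.exp_nonneg _)).trans ?_
      rw [← Real.exp_add]
      refine Real.exp_le_exp.2 (le_of_eq ?_)
      push_cast
      ring
    · intro f g
      have h : ∀ x ∈ X, splice {e | ∃ x ∈ X, e = s(w, x)} f g s(w, x) = f s(w, x) :=
        fun x hx => splice_of_mem ⟨x, hx, rfl⟩
      rw [Finset.sum_congr rfl fun x hx => by rw [h x hx]]
    · intro f g
      refine Finset.prod_congr rfl fun w' hw' => ?_
      have h : ∀ x ∈ X, splice {e | ∃ x ∈ X, e = s(w, x)} f g s(w', x) = g s(w', x) := by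
        refine fun x hx => splice_of_notMem ?_
        rintro ⟨y, hy, h⟩
        rw [Sym2.eq_iff] at h
        rcases h with ⟨rfl, -⟩ | ⟨rfl, -⟩
        · exact hw hw'
        · exact hXW w' (Finset.mem_insert_of_mem hw') hy
      rw [Finset.sum_congr rfl fun x hx => by rw [h x hx]]

/-- Laplace transform bound for the size of the next layer, conditionally on the edges revealed
so far. -/
lemma bernExp_exp_Sat_le {p t : ℝ} (h0 : 0 ≤ p) (h1 : p ≤ 1) (ht : 0 ≤ t)
    (G₀ : SimpleGraph (Fin n)) {u v : Fin n} (huv : u ≠ v) (k : ℕ) (f : Sym2 (Fin n) → Bool)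
    (hs : (Sat (perturb G₀ f) u v k).ncard * p ≤ 1) :
    bernExp p (fun g => Real.exp (-(t *
      (Sat (perturb G₀ (splice (revealed G₀ u v k f) f g)) u v (k + 1)).ncard))) ≤
    Real.exp (-((1 - Real.exp (-t)) * ((Sat (perturb G₀ f) u v k).ncard * p *
      (1 - (Sat (perturb G₀ f) u v k).ncard * p)) *
        (n - (Sbelow (perturb G₀ f) u v (k + 1)).ncard))) := by
  classical
  set R := revealed G₀ u v k f with hR
  set X := (Sat (perturb G₀ f) u v k).toFinset with hXdef
  set W := (Sbelow (perturb G₀ f) u v (k + 1)).toFinsetᶜ with hWdef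
  have hXc : (Sat (perturb G₀ f) u v k).ncard = X.card := Set.ncard_eq_toFinset_card' _
  have hWc : (n : ℝ) - (Sbelow (perturb G₀ f) u v (k + 1)).ncard = W.card := by
    rw [hWdef, Finset.card_compl, Set.ncard_eq_toFinset_card', Fintype.card_fin,
      Nat.cast_sub]
    simpa using Finset.card_le_univ (Sbelow (perturb G₀ f) u v (k + 1)).toFinset
  set d := signedWalk (perturb G₀ f) u v k with hd
  have hmain : ∀ g w, w ∈ W →
      signedWalk (perturb G₀ (splice R f g)) u v (k + 1) w =
      (∑ x ∈ (Sbelow (perturb G₀ f) u v k).toFinset,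
        if (perturb G₀ f).Adj w x then d x else 0) +
      ∑ x ∈ X, (if Xor (G₀.Adj w x) (g s(w, x) = true) then d x else 0) := by
    intro g w hw
    have hw' : w ∉ Sbelow (perturb G₀ f) u v (k + 1) := by simpa [hWdef] using hw
    rw [signedWalk, signedWalk_congr huv (perturb_splice_adj G₀ u v k f g) k le_rfl]
    have hdisj : Disjoint (Sbelow (perturb G₀ f) u v k).toFinset X := by
      rw [Set.disjoint_toFinset]
      exact Set.disjoint_sdiff_right
    rw [← Finset.sum_subset (Finset.subset_univ
      ((Sbelow (perturb G₀ f) u v k).toFinset ∪ X)), Finset.sum_union hdisj]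
    · congr 1
      · refine Finset.sum_congr rfl fun x hx => ?_
        exact if_congr (perturb_splice_adj G₀ u v k f g w x (by simpa using hx)) rfl rfl
      · refine Finset.sum_congr rfl fun x hx => ?_
        have hx' : x ∈ Sat (perturb G₀ f) u v k := by simpa [hXdef] using hx
        refine if_congr ?_ rfl rfl
        rw [perturb_adj, splice_of_notMem]
        · refine and_iff_right ?_
          rintro rfl
          exact hw' hx'.1
        · rintro ⟨y, hy, hy'⟩
          rw [Sym2.mem_iff] at hy
          rcases hy with rfl | rfl
          · exact hw' (Sbelow_mono _ _ _ k.le_succ hy')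
          · exact hx'.2 hy'
    · intro x _ hx
      rw [Finset.mem_union, not_or] at hx
      have : signedWalk (perturb G₀ f) u v k x = 0 := by
        by_contra hne
        refine hx.2 ?_
        rw [hXdef, Set.mem_toFinset, mem_Sat_iff _ huv]
        exact ⟨by simpa using hx.1, hne⟩
      simp [this]
  have hSat : ∀ g, (Sat (perturb G₀ (splice R f g)) u v (k + 1)).ncard =
      (W.filter fun w => (∑ x ∈ (Sbelow (perturb G₀ f) u v k).toFinset,
        if (perturb G₀ f).Adj w x then d x else 0) +
      ∑ x ∈ X, (if Xor (G₀.Adj w x) (g s(w, x) = true) then d x else 0) ≠ 0).card := by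
    intro g
    rw [Set.ncard_eq_toFinset_card']
    congr 1
    ext w
    rw [Set.mem_toFinset, mem_Sat_iff _ huv, Finset.mem_filter,
      Sbelow_congr huv (perturb_splice_adj G₀ u v k f g) le_rfl]
    have : w ∈ W ↔ w ∉ Sbelow (perturb G₀ f) u v (k + 1) := by simp [hWdef]
    rw [← this]
    refine and_congr_right fun hw => ?_
    rw [hmain g w hw]
  have hprod := bernExp_prod_le (a := Real.exp (-t)) h0 h1 (Real.exp_nonneg _)
    (Real.exp_le_one_iff.2 (by linarith)) G₀ X W
    (fun w hw hx => by
      have h2 : w ∉ Sbelow (perturb G₀ f) u v (k + 1) := by simpa [hWdef] using hw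
      have h3 : w ∈ Sat (perturb G₀ f) u v k := by simpa [hXdef] using hx
      exact h2 h3.1) (by rwa [hXc] at hs)
    (fun w => ∑ x ∈ (Sbelow (perturb G₀ f) u v k).toFinset,
        if (perturb G₀ f).Adj w x then d x else 0) d
    (fun x hx => ((mem_Sat_iff _ huv k x).1 (by simpa [hXdef] using hx)).2)
  rw [hWc, hXc]
  refine le_trans (le_of_eq ?_) hprod
  congr 1
  ext g
  rw [hSat, Finset.prod_ite]
  simp only [Finset.prod_const_one, one_mul, Finset.prod_const]
  rw [← Real.exp_nat_mul]
  congr 1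
  ring

/-- Before time `i`, few vertices are active and every layer is small. -/
def SmallUpTo {V : Type*} [Fintype V] (G : SimpleGraph V) (u v : V) (M A : ℝ) (i : ℕ) : Prop :=
  ((Sbelow G u v i).ncard : ℝ) ≤ M ∧ ∀ j < i, ((Sat G u v j).ncard : ℝ) < A

/-- At time `i`, the set of active vertices has size at least `T` but fails to grow by a
factor `r`, although it was still small. -/
def Stalls {V : Type*} [Fintype V] (G : SimpleGraph V) (u v : V) (M A T r : ℝ) (i : ℕ) : Prop :=
  SmallUpTo G u v M A i ∧ T ≤ ((Sbelow G u v i).ncard : ℝ) ∧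
    ((Sbelow G u v (i + 1)).ncard : ℝ) < r * (Sbelow G u v i).ncard

lemma exists_le_ncard_Sat {V : Type*} [Fintype V] (G : SimpleGraph V) (u v : V)
    {M A T r : ℝ} (hT0 : 0 < T) (hr : 1 < r) (hTM : T ≤ M / 2) (hAM : A ≤ M / 2)
    (hArM : A ≤ (r - 1) * (M / 2)) (hT : ∃ i, T ≤ ((Sbelow G u v i).ncard : ℝ))
    (hstall : ∀ i, ¬ Stalls G u v M A T r i) : ∃ j, A ≤ ((Sat G u v j).ncard : ℝ) := by
  classical
  by_contra! hsmall
  have hgrow : ∀ i, ((Sbelow G u v i).ncard : ℝ) ≤ M → T ≤ ((Sbelow G u v i).ncard : ℝ) →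
      r * (Sbelow G u v i).ncard ≤ ((Sbelow G u v (i + 1)).ncard : ℝ) := by
    intro i hi hTi
    by_contra! hlt
    exact hstall i ⟨⟨hi, fun j _ => hsmall j⟩, hTi, hlt⟩
  have hsucc : ∀ i, ((Sbelow G u v (i + 1)).ncard : ℝ) =
      (Sbelow G u v i).ncard + (Sat G u v i).ncard := fun i => by
    exact_mod_cast ncard_Sbelow_succ G u v i
  by_cases hM : ∃ i, M < ((Sbelow G u v i).ncard : ℝ)
  · have h1 := Nat.find_spec hM
    have h2 := fun j => Nat.find_min (m := j) hM
    rcases hi : Nat.find hM with _ | i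
    · rw [hi, Sbelow_zero] at h1
      simp at h1
      linarith
    · rw [hi] at h1
      have h3 := not_lt.1 (h2 i (by omega))
      have h4 := hsmall i
      rw [hsucc] at h1
      have h5 : M / 2 ≤ ((Sbelow G u v i).ncard : ℝ) := by linarith
      have h6 := hgrow i h3 (hTM.trans h5)
      rw [hsucc] at h6
      nlinarith [mul_le_mul_of_nonneg_left h5 (sub_pos.2 hr).le]
  · push Not at hM
    obtain ⟨i, hi⟩ := hT
    have h1 : ∀ k : ℕ, T ≤ ((Sbelow G u v (i + k)).ncard : ℝ) ∧
        k ≤ (Sbelow G u v (i + k)).ncard := by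
      intro k
      induction k with
      | zero => exact ⟨hi, by omega⟩
      | succ k ih =>
        have h2 := hgrow (i + k) (hM _) ih.1
        have h3 : ((Sbelow G u v (i + k)).ncard : ℝ) < (Sbelow G u v (i + k + 1)).ncard := by
          nlinarith [ih.1]
        refine ⟨ih.1.trans h3.le, ?_⟩
        have h4 : (Sbelow G u v (i + k)).ncard < (Sbelow G u v (i + k + 1)).ncard := by
          exact_mod_cast h3
        have := ih.2
        rw [← add_assoc]
        omega
    have h2 := (h1 (⌊M⌋₊ + 1)).2
    have h3 := hM (i + (⌊M⌋₊ + 1))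
    have h4 := Nat.lt_floor_add_one M
    have h5 : ((⌊M⌋₊ + 1 : ℕ) : ℝ) ≤ (Sbelow G u v (i + (⌊M⌋₊ + 1))).ncard := by
      exact_mod_cast h2
    push_cast at h5
    linarith

open Classical in
/-- The exponential supermartingale of the exploration, frozen at the value `C` once the
exploration stalls and at `0` once it is no longer small. -/
noncomputable def stoppedPotential {V : Type*} [Fintype V] (G : SimpleGraph V) (u v : V)
    (M A T r t κ C : ℝ) (k : ℕ) : ℝ :=
  if ∃ i < k, Stalls G u v M A T r i then C
  else if SmallUpTo G u v M A k then
    Real.exp (κ * (Sbelow G u v k).ncard - t * (Sbelow G u v (k + 1)).ncard)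
  else 0

lemma SmallUpTo.of_succ {V : Type*} [Fintype V] {G : SimpleGraph V} {u v : V} {M A : ℝ} {k : ℕ}
    (h : SmallUpTo G u v M A (k + 1)) : SmallUpTo G u v M A k := by
  refine ⟨le_trans ?_ h.1, fun j hj => h.2 j (by omega)⟩
  exact_mod_cast Set.ncard_le_ncard (Sbelow_mono G u v k.le_succ) (Set.toFinite _)

lemma bernExp_stoppedPotential_succ_le {p t κ M A T r C : ℝ} (h0 : 0 ≤ p) (h1 : p ≤ 1)
    (ht : 0 ≤ t) (hAp : A * p ≤ 1) (hMn : M ≤ n)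
    (hκ : κ ≤ (1 - Real.exp (-t)) * p * (1 - A * p) * (n - M))
    (hr : t * r ≤ κ) (hC : C ≤ Real.exp ((κ - t * r) * T))
    (G₀ : SimpleGraph (Fin n)) {u v : Fin n} (huv : u ≠ v) (k : ℕ) :
    bernExp p (fun f => stoppedPotential (perturb G₀ f) u v M A T r t κ C (k + 1)) ≤
      bernExp p (fun f => stoppedPotential (perturb G₀ f) u v M A T r t κ C k) := by
  classical
  have h1e : 0 ≤ 1 - Real.exp (-t) := sub_nonneg.2 (Real.exp_le_one_iff.2 (by linarith))
  rw [bernExp_resample p (revealed G₀ u v k) (revealed_splice G₀ huv k)]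
  refine bernExp_mono h0 h1 fun f => ?_
  have hB : ∀ g, ∀ j ≤ k + 1,
      Sbelow (perturb G₀ (splice (revealed G₀ u v k f) f g)) u v j =
        Sbelow (perturb G₀ f) u v j :=
    fun g j hj => Sbelow_congr huv (perturb_splice_adj G₀ u v k f g) hj
  have hS : ∀ g, ∀ j ≤ k,
      Sat (perturb G₀ (splice (revealed G₀ u v k f) f g)) u v j = Sat (perturb G₀ f) u v j :=
    fun g j hj => Sat_congr huv (perturb_splice_adj G₀ u v k f g) hj
  have hsmall : ∀ g, ∀ j ≤ k + 1,
      (SmallUpTo (perturb G₀ (splice (revealed G₀ u v k f) f g)) u v M A j ↔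
        SmallUpTo (perturb G₀ f) u v M A j) := by
    intro g j hj
    rw [SmallUpTo, SmallUpTo, hB g j hj]
    refine and_congr_right fun _ => forall_congr' fun i => ?_
    refine forall_congr' fun hi => ?_
    rw [hS g i (by omega)]
  have hstall : ∀ g,
      (∃ i < k + 1, Stalls (perturb G₀ (splice (revealed G₀ u v k f) f g)) u v M A T r i) ↔
        ∃ i < k + 1, Stalls (perturb G₀ f) u v M A T r i := by
    intro g
    refine exists_congr fun i => and_congr_right fun hi => ?_
    rw [Stalls, Stalls, hsmall g i (by omega), hB g i (by omega), hB g (i + 1) (by omega)]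
  have hnonneg : 0 ≤ (if SmallUpTo (perturb G₀ f) u v M A k then
      Real.exp (κ * (Sbelow (perturb G₀ f) u v k).ncard -
        t * (Sbelow (perturb G₀ f) u v (k + 1)).ncard) else 0) := by
    split_ifs
    · exact Real.exp_nonneg _
    · exact le_rfl
  simp only [stoppedPotential, hstall, hsmall _ _ le_rfl, hB _ _ le_rfl]
  by_cases hst : ∃ i < k + 1, Stalls (perturb G₀ f) u v M A T r i
  · simp only [if_pos hst, bernExp_const]
    by_cases hst' : ∃ i < k, Stalls (perturb G₀ f) u v M A T r i
    · rw [if_pos hst']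
    · obtain ⟨i, hi, hsi⟩ := hst
      obtain rfl : i = k := by
        by_contra hne
        exact hst' ⟨i, by omega, hsi⟩
      obtain ⟨hsm, hTi, hlt⟩ := hsi
      rw [if_neg hst', if_pos hsm]
      refine hC.trans (Real.exp_le_exp.2 ?_)
      nlinarith [mul_le_mul_of_nonneg_left hTi (sub_nonneg.2 hr),
        mul_le_mul_of_nonneg_left hlt.le ht]
  · have hst' : ¬ ∃ i < k, Stalls (perturb G₀ f) u v M A T r i :=
      fun ⟨i, hi, h⟩ => hst ⟨i, by omega, h⟩
    simp only [if_neg hst, if_neg hst']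
    by_cases hsm : SmallUpTo (perturb G₀ f) u v M A (k + 1)
    · simp only [if_pos hsm, if_pos hsm.of_succ]
      have hsA := (hsm.2 k (by omega)).le
      have hsp : (Sat (perturb G₀ f) u v k).ncard * p ≤ A * p :=
        mul_le_mul_of_nonneg_right hsA h0
      have hL := bernExp_exp_Sat_le h0 h1 ht G₀ huv k f (hsp.trans hAp)
      have hsplit : ∀ g, Real.exp (κ * (Sbelow (perturb G₀ f) u v (k + 1)).ncard - t *
          (Sbelow (perturb G₀ (splice (revealed G₀ u v k f) f g)) u v (k + 1 + 1)).ncard) =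
          Real.exp (κ * (Sbelow (perturb G₀ f) u v (k + 1)).ncard -
            t * (Sbelow (perturb G₀ f) u v (k + 1)).ncard) *
          Real.exp (-(t *
            (Sat (perturb G₀ (splice (revealed G₀ u v k f) f g)) u v (k + 1)).ncard)) := by
        intro g
        rw [← Real.exp_add, ncard_Sbelow_succ _ u v (k + 1), hB g (k + 1) le_rfl]
        congr 1
        push_cast
        ring
      simp only [hsplit, bernExp_const_mul]
      refine (mul_le_mul_of_nonneg_left hL (Real.exp_nonneg _)).trans ?_
      rw [← Real.exp_add]
      refine Real.exp_le_exp.2 ?_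
      have hq : κ * (Sat (perturb G₀ f) u v k).ncard ≤
          (1 - Real.exp (-t)) * ((Sat (perturb G₀ f) u v k).ncard * p *
            (1 - (Sat (perturb G₀ f) u v k).ncard * p)) *
            (n - (Sbelow (perturb G₀ f) u v (k + 1)).ncard) := by
        set s : ℝ := ((Sat (perturb G₀ f) u v k).ncard : ℝ) with hs
        have hs0 : 0 ≤ s := Nat.cast_nonneg _
        calc κ * s ≤ (1 - Real.exp (-t)) * p * (1 - A * p) * (n - M) * s :=
              mul_le_mul_of_nonneg_right hκ hs0
          _ = ((1 - Real.exp (-t)) * (s * p)) * ((1 - A * p) * (n - M)) := by ring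
          _ ≤ ((1 - Real.exp (-t)) * (s * p)) *
              ((1 - s * p) * (n - (Sbelow (perturb G₀ f) u v (k + 1)).ncard)) := by
            refine mul_le_mul_of_nonneg_left ?_ (by positivity)
            exact mul_le_mul (by linarith) (by linarith [hsm.1]) (by linarith)
              (by linarith)
          _ = _ := by ring
      have h2 : ((Sbelow (perturb G₀ f) u v (k + 1)).ncard : ℝ) =
          (Sbelow (perturb G₀ f) u v k).ncard + (Sat (perturb G₀ f) u v k).ncard := by
        exact_mod_cast ncard_Sbelow_succ _ u v k
      have h3 : κ * ((Sbelow (perturb G₀ f) u v (k + 1)).ncard : ℝ) =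
          κ * (Sbelow (perturb G₀ f) u v k).ncard + κ * (Sat (perturb G₀ f) u v k).ncard := by
        rw [h2]; ring
      linarith
    · simp only [if_neg hsm, bernExp_const]
      exact hnonneg

open Classical in
/-- The exploration from `u, v` is unlikely to stall. -/
lemma bernExp_exists_stalls_le {p t κ M A T r : ℝ} (h0 : 0 ≤ p) (h1 : p ≤ 1)
    (ht : 0 ≤ t) (hAp : A * p ≤ 1) (hMn : M ≤ n)
    (hκ : κ ≤ (1 - Real.exp (-t)) * p * (1 - A * p) * (n - M)) (hr : t * r ≤ κ)
    (G₀ : SimpleGraph (Fin n)) {u v : Fin n} (huv : u ≠ v) :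
    bernExp p (fun f => if ∃ i, Stalls (perturb G₀ f) u v M A T r i then 1 else 0) ≤
      Real.exp (-((κ - t * r) * T)) := by
  set C := Real.exp ((κ - t * r) * T) with hC
  have hanti : ∀ k,
      bernExp p (fun f => stoppedPotential (perturb G₀ f) u v M A T r t κ C k) ≤ 1 := by
    intro k
    induction k with
    | zero =>
      rw [← bernExp_one (ι := Sym2 (Fin n)) p]
      refine bernExp_mono h0 h1 fun f => ?_
      simp only [stoppedPotential, Nat.not_lt_zero, false_and, exists_false, if_false, Sbelow_zero]
      split_ifs
      · rw [Real.exp_le_one_iff, Set.ncard_empty]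
        simp only [Nat.cast_zero, mul_zero, zero_sub, Left.neg_nonpos_iff]
        positivity
      · exact zero_le_one
    | succ k ih =>
      exact (bernExp_stoppedPotential_succ_le h0 h1 ht hAp hMn hκ hr le_rfl G₀ huv k).trans ih
  obtain ⟨N, hN⟩ : ∃ N, ∀ f : Sym2 (Fin n) → Bool,
      (∃ i, Stalls (perturb G₀ f) u v M A T r i) →
        ∃ i < N, Stalls (perturb G₀ f) u v M A T r i := by
    choose! τ hτ using fun (f : Sym2 (Fin n) → Bool)
      (h : ∃ i, Stalls (perturb G₀ f) u v M A T r i) => h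
    refine ⟨Finset.univ.sup τ + 1, fun f hf => ⟨τ f, ?_, hτ f hf⟩⟩
    exact Nat.lt_succ_of_le (Finset.le_sup (Finset.mem_univ f))
  have h2 : C * bernExp p
      (fun f => if ∃ i, Stalls (perturb G₀ f) u v M A T r i then 1 else 0) ≤ 1 := by
    rw [← bernExp_const_mul]
    refine (bernExp_mono h0 h1 fun f => ?_).trans (hanti N)
    by_cases h : ∃ i, Stalls (perturb G₀ f) u v M A T r i
    · rw [stoppedPotential, if_pos (hN f h), if_pos h, mul_one]
    · rw [if_neg h, mul_zero, stoppedPotential]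
      split_ifs
      · exact Real.exp_nonneg _
      · exact Real.exp_nonneg _
      · exact le_rfl
  rwa [Real.exp_neg, ← hC, inv_eq_one_div, le_div_iff₀' (Real.exp_pos _)]


lemma erdosRenyiMeasure_apply {n : ℕ} {p : ℝ} (h0 : 0 ≤ p) (h1 : p ≤ 1)
    (S : Set (Sym2 (Fin n) → Bool)) [DecidablePred (· ∈ S)] :
    erdosRenyiMeasure n p S = ENNReal.ofReal (bernExp p (fun f => if f ∈ S then 1 else 0)) := by
  rw [erdosRenyiMeasure, bernoulliProduct, bernExp, ENNReal.ofReal_sum_of_nonneg]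
  · rw [Measure.finsetSum_apply]
    refine Finset.sum_congr rfl fun f _ => ?_
    rw [Measure.smul_apply, Measure.dirac_apply, ENNReal.ofReal_mul (bernWeight_nonneg h0 h1 f),
      bernWeight, ENNReal.ofReal_prod_of_nonneg, smul_eq_mul]
    · congr 1
      · refine Finset.prod_congr rfl fun i _ => ?_
        split_ifs <;> rfl
      · by_cases hf : f ∈ S <;> simp [hf]
    · intro i _
      split_ifs <;> linarith
  · intro f _
    refine mul_nonneg (bernWeight_nonneg h0 h1 f) ?_
    split_ifs <;> norm_num

/-- The numerical inequality behind the choice of parameters in the stalling bound. -/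
lemma stalling_exponent_bound {x q η p M : ℝ} (hη0 : 0 < η) (hη1 : η ≤ 1)
    (hx : 1 + η ≤ x * p) (hM : M = η * x / 100)
    (hq : q ≤ η / 100) :
    η ^ 2 / 10 ≤ (1 - Real.exp (-(η / 2))) * p * (1 - q) * (x - M) -
      η / 2 * (1 + η / 10) := by
  have he : (η / 2) / (1 + η / 2) ≤ 1 - Real.exp (-(η / 2)) := by
    have h1 : Real.exp (-(η / 2)) ≤ 1 / (1 + η / 2) := by
      rw [Real.exp_neg, inv_eq_one_div]
      exact one_div_le_one_div_of_le (by linarith) (by linarith [Real.add_one_le_exp (η / 2)])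
    have h2 : (η / 2) / (1 + η / 2) = 1 - 1 / (1 + η / 2) := by field_simp; ring
    linarith
  have hgrow : (1 + η) * (1 - η / 100) ^ 2 ≤ p * (1 - q) * (x - M) := by
    calc (1 + η) * (1 - η / 100) ^ 2 ≤ (x * p) * (1 - η / 100) ^ 2 :=
          mul_le_mul_of_nonneg_right hx (sq_nonneg _)
      _ = (x * p * (1 - η / 100)) * (1 - η / 100) := by ring
      _ ≤ (x * p * (1 - η / 100)) * (1 - q) :=
          mul_le_mul_of_nonneg_left (by linarith)
            (mul_nonneg (by linarith) (by linarith))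
      _ = p * (1 - q) * (x - M) := by rw [hM]; ring
  have hbase : η / 2 * (1 + 3 * η / 10) ≤
      (η / 2) / (1 + η / 2) * ((1 + η) * (1 - η / 100) ^ 2) := by
    rw [div_mul_eq_mul_div (η / 2), le_div_iff₀ (by linarith), mul_assoc]
    refine mul_le_mul_of_nonneg_left ?_ (by linarith)
    nlinarith [mul_pos hη0 hη0, mul_nonneg hη0.le (sub_nonneg.2 hη1),
      mul_nonneg (mul_pos hη0 hη0).le (sub_nonneg.2 hη1)]
  have := mul_le_mul he hgrow (by positivity) (le_trans (by positivity) he)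
  nlinarith

/-- For admissible parameters, every pair whose exploration reaches size `T` eventually has a
layer of size `A`, except with probability at most `n ^ 2 exp (-10 ℓ)`. -/
lemma le_erdosRenyiMeasure_of_params {n : ℕ} {p η A ℓ : ℝ} (h0 : 0 ≤ p) (h1 : p ≤ 1)
    (hη0 : 0 < η) (hη1 : η ≤ 1) (hℓ : 0 < ℓ) (hnp : 1 + η ≤ n * p) (hAp : A * p ≤ η / 100)
    (hT : 100 * ℓ / η ^ 2 ≤ η * n / 200) (hA : A ≤ η ^ 2 * n / 2000)
    (G₀ : SimpleGraph (Fin n)) :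
    ENNReal.ofReal (1 - (n : ℝ) ^ 2 * Real.exp (-(10 * ℓ))) ≤ erdosRenyiMeasure n p
      {f | ∀ u v : Fin n, u ≠ v →
        (∃ i : ℕ, 100 * ℓ / η ^ 2 ≤ (Nat.card ↥(Sle (perturb G₀ f) u v i) : ℝ)) →
        ∃ j : ℕ, A ≤ (Nat.card ↥(Sat (perturb G₀ f) u v j) : ℝ)} := by
  classical
  rw [erdosRenyiMeasure_apply h0 h1]
  refine ENNReal.ofReal_le_ofReal ?_
  set M := η * n / 100 with hM
  set T := 100 * ℓ / η ^ 2 with hTdef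
  set r := 1 + η / 10 with hr
  have hn0 : (0 : ℝ) ≤ n := Nat.cast_nonneg n
  have hstall : ∀ u v : Fin n, u ≠ v → bernExp p (fun f : Sym2 (Fin n) → Bool =>
      if ∃ i, Stalls (perturb G₀ f) u v M A T r i then 1 else 0) ≤
        Real.exp (-(10 * ℓ)) := by
    intro u v huv
    have hb := stalling_exponent_bound hη0 hη1 hnp hM hAp
    refine (bernExp_exists_stalls_le h0 h1 (by positivity : 0 ≤ η / 2) (by linarith)
      (by rw [hM]; nlinarith) le_rfl (by nlinarith [sq_nonneg η]) G₀ huv).trans ?_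
    refine Real.exp_le_exp.2 (neg_le_neg ?_)
    calc 10 * ℓ = η ^ 2 / 10 * T := by rw [hTdef]; field_simp; ring
      _ ≤ _ := mul_le_mul_of_nonneg_right hb (by positivity)
  have hpt : ∀ f : Sym2 (Fin n) → Bool,
      1 - ∑ u : Fin n, ∑ v : Fin n, (if u ≠ v then
        (if ∃ i, Stalls (perturb G₀ f) u v M A T r i then (1 : ℝ) else 0) else 0) ≤
      if f ∈ {f | ∀ u v : Fin n, u ≠ v →
        (∃ i : ℕ, T ≤ (Nat.card ↥(Sle (perturb G₀ f) u v i) : ℝ)) →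
        ∃ j : ℕ, A ≤ (Nat.card ↥(Sat (perturb G₀ f) u v j) : ℝ)} then 1 else 0 := by
    intro f
    have hnn : ∀ u v : Fin n, 0 ≤ (if u ≠ v then
        (if ∃ i, Stalls (perturb G₀ f) u v M A T r i then (1 : ℝ) else 0) else 0) := by
      intro u v
      split_ifs <;> norm_num
    split_ifs with hf
    · linarith [Finset.sum_nonneg fun u (_ : u ∈ Finset.univ) =>
        Finset.sum_nonneg fun v (_ : v ∈ Finset.univ) => hnn u v]
    · simp only [Set.mem_ofPred_eq, Nat.card_coe_set_eq] at hf
      push Not at hf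
      obtain ⟨u, v, huv, ⟨i, hi⟩, hlt⟩ := hf
      have hbad : ∃ i, Stalls (perturb G₀ f) u v M A T r i := by
        by_contra! hno
        obtain ⟨j, hj⟩ := exists_le_ncard_Sat (perturb G₀ f) u v (M := M) (A := A) (T := T)
          (r := r) (by positivity) (by rw [hr]; linarith) (by rw [hM]; linarith)
          (by rw [hM]; nlinarith [mul_nonneg hη0.le hn0]) (by rw [hM, hr]; nlinarith)
          ⟨i + 1, hi⟩ hno
        exact (hlt j).not_ge hj
      have h2 : (1 : ℝ) ≤ ∑ v : Fin n, (if u ≠ v then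
          (if ∃ i, Stalls (perturb G₀ f) u v M A T r i then (1 : ℝ) else 0) else 0) := by
        refine le_trans (le_of_eq ?_)
          (Finset.single_le_sum (fun v _ => hnn u v) (Finset.mem_univ v))
        rw [if_pos huv, if_pos hbad]
      have h3 := h2.trans (Finset.single_le_sum
        (f := fun u => ∑ v : Fin n, (if u ≠ v then
          (if ∃ i, Stalls (perturb G₀ f) u v M A T r i then (1 : ℝ) else 0) else 0))
        (fun u _ => Finset.sum_nonneg fun v _ => hnn u v) (Finset.mem_univ u))
      linarith
  refine le_trans ?_ (bernExp_mono h0 h1 hpt)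
  rw [bernExp_sub, bernExp_one, bernExp_sum]
  refine sub_le_sub_left ?_ 1
  calc ∑ u : Fin n, bernExp p (fun f : Sym2 (Fin n) → Bool => ∑ v : Fin n, (if u ≠ v then
        (if ∃ i, Stalls (perturb G₀ f) u v M A T r i then (1 : ℝ) else 0) else 0))
      ≤ ∑ _u : Fin n, ∑ _v : Fin n, Real.exp (-(10 * ℓ)) := by
        refine Finset.sum_le_sum fun u _ => ?_
        rw [bernExp_sum]
        refine Finset.sum_le_sum fun v _ => ?_
        by_cases huv : u = v
        · simp only [huv, ne_eq, not_true, if_false, bernExp_const]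
          exact Real.exp_nonneg _
        · simpa only [ne_eq, huv, not_false_eq_true, if_true] using hstall u v huv
    _ = (n : ℝ) ^ 2 * Real.exp (-(10 * ℓ)) := by
        simp only [Finset.sum_const, Finset.card_univ, Fintype.card_fin, nsmul_eq_mul]
        ring

end Exploration

/-- Lemma 4.2.
For `p = p_n ∈ [0,1/2]` with (eventually) `(1+(log n)^{-40})/n ≤ p ≤ 100·log n/n`, and any
sequence `G₀`, whp `G = G₀ △ G_rand` has the property: for all distinct `u,v` such that
`|S^{≤i}_G({u,v})| ≥ 100 log n / min((np-1)², 1)` for some `i`, there is some `j` with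
`|S^j_G({u,v})| ≥ n/(4 (log n)^{140})`. -/
theorem stmt5 (p : ℕ → ℝ) (hp0 : ∀ n, 0 ≤ p n) (hp1 : ∀ n, p n ≤ 1 / 2)
    (hlb : ∀ᶠ n : ℕ in atTop, (1 + ((Real.log n) ^ 40)⁻¹) / n ≤ p n)
    (hub : ∀ᶠ n : ℕ in atTop, p n ≤ 100 * Real.log n / n)
    (G₀ : (n : ℕ) → SimpleGraph (Fin n)) :
    Tendsto (fun n : ℕ =>
      erdosRenyiMeasure n (p n)
        {f | ∀ u v : Fin n, u ≠ v →
          (∃ i : ℕ, 100 * Real.log n / min ((n * p n - 1) ^ 2) 1 ≤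
            (Nat.card ↥(Sle (symmDiffG (G₀ n) (graphOfFlip f)) u v i) : ℝ)) →
          ∃ j : ℕ, (n : ℝ) / (4 * (Real.log n) ^ 140) ≤
            (Nat.card ↥(Sat (symmDiffG (G₀ n) (graphOfFlip f)) u v j) : ℝ)})
      atTop (nhds 1) := by
  classical
  have hlog : ∀ᶠ n : ℕ in atTop, (2500 : ℝ) ≤ Real.log n :=
    (Real.tendsto_log_atTop.comp tendsto_natCast_atTop_atTop).eventually_ge_atTop 2500
  have hpoly : ∀ᶠ n : ℕ in atTop, 20000 * Real.log n ^ 121 ≤ (n : ℝ) := by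
    have h := (Real.isLittleO_pow_log_id_atTop (n := 121)).bound
      (show (0 : ℝ) < 1 / 20000 by norm_num)
    filter_upwards [tendsto_natCast_atTop_atTop.eventually h] with n hn
    rw [id, Real.norm_natCast] at hn
    linarith [le_abs_self (Real.log n ^ 121), Real.norm_eq_abs (Real.log n ^ 121)]
  have hlim : Tendsto (fun n : ℕ => ENNReal.ofReal (1 - 1 / (n : ℝ))) atTop (nhds 1) := by
    have h : Tendsto (fun n : ℕ => 1 - 1 / (n : ℝ)) atTop (nhds 1) := by
      simpa using tendsto_const_nhds.sub (tendsto_one_div_atTop_nhds_zero_nat (𝕜 := ℝ))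
    simpa using ENNReal.tendsto_ofReal h
  refine tendsto_of_tendsto_of_tendsto_of_le_of_le' hlim tendsto_const_nhds ?_ ?_
  · filter_upwards [hlb, hub, hlog, hpoly, eventually_gt_atTop 0] with n hl hu hL hP hn
    set L := Real.log n with hLdef
    have hn0 : (0 : ℝ) < n := by exact_mod_cast hn
    have hn1 : (1 : ℝ) ≤ n := by exact_mod_cast hn
    have hL0 : 0 < L := by linarith
    have hLpow : ∀ k : ℕ, k ≠ 0 → 2500 ≤ L ^ k := fun k hk =>
      hL.trans (le_self_pow₀ (by linarith) hk)
    have hnp : 1 + (L ^ 40)⁻¹ ≤ n * p n := by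
      rwa [div_le_iff₀' hn0] at hl
    set η := min (n * p n - 1) 1 with hη
    have hLinv : 0 < (L ^ 40)⁻¹ := by positivity
    have hηL : (L ^ 40)⁻¹ ≤ η :=
      le_min (by linarith) (inv_le_one_of_one_le₀ (by linarith [hLpow 40 (by norm_num)]))
    have hη0 : 0 < η := hLinv.trans_le hηL
    have hη1 : η ≤ 1 := min_le_right _ _
    have hηmul : 1 ≤ η * L ^ 40 := by
      have := mul_le_mul_of_nonneg_right hηL (by positivity : 0 ≤ L ^ 40)
      rwa [inv_mul_cancel₀ (by positivity)] at this
    have hmin : min ((n * p n - 1) ^ 2) 1 = η ^ 2 := by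
      rcases le_total (n * p n - 1) 1 with h | h
      · rw [hη, min_eq_left h, min_eq_left]
        nlinarith
      · rw [hη, min_eq_right h, one_pow, min_eq_right]
        nlinarith
    have hAp : (n : ℝ) / (4 * L ^ 140) * p n ≤ η / 100 := by
      calc (n : ℝ) / (4 * L ^ 140) * p n ≤ (n : ℝ) / (4 * L ^ 140) * (100 * L / n) :=
            mul_le_mul_of_nonneg_left hu (by positivity)
        _ = 25 / L ^ 139 := by field_simp; ring
        _ ≤ η / 100 := by
          rw [div_le_div_iff₀ (by positivity) (by norm_num)]
          nlinarith [mul_le_mul hηmul (hLpow 99 (by norm_num)) (by norm_num) (by positivity)]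
    have hT : 100 * L / η ^ 2 ≤ η * n / 200 := by
      rw [div_le_div_iff₀ (by positivity) (by norm_num)]
      have h3 : 1 ≤ (η * L ^ 40) ^ 3 := one_le_pow₀ hηmul
      calc 100 * L * 200 ≤ 20000 * L * (η * L ^ 40) ^ 3 := by nlinarith
        _ = η ^ 3 * (20000 * L ^ 121) := by ring
        _ ≤ η ^ 3 * n := mul_le_mul_of_nonneg_left hP (by positivity)
        _ = η * n * η ^ 2 := by ring
    have hA : (n : ℝ) / (4 * L ^ 140) ≤ η ^ 2 * n / 2000 := by
      rw [div_le_div_iff₀ (by positivity) (by norm_num)]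
      have h2 : 1 ≤ (η * L ^ 40) ^ 2 := one_le_pow₀ hηmul
      have h3 := mul_le_mul h2 (hLpow 60 (by norm_num)) (by norm_num) (by positivity)
      calc (n : ℝ) * 2000 ≤ n * (4 * ((η * L ^ 40) ^ 2 * L ^ 60)) :=
            mul_le_mul_of_nonneg_left (by linarith) hn0.le
        _ = η ^ 2 * n * (4 * L ^ 140) := by ring
    have hmain := le_erdosRenyiMeasure_of_params (hp0 n) (by linarith [hp1 n]) hη0 hη1 hL0
      (by linarith [min_le_left (n * p n - 1) 1]) hAp hT hA (G₀ n)
    rw [hmin]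
    refine le_trans (ENNReal.ofReal_le_ofReal (sub_le_sub_left ?_ 1)) hmain
    have hexp : Real.exp (-(10 * L)) = ((n : ℝ) ^ 10)⁻¹ := by
      rw [Real.exp_neg, ← Real.exp_log hn0, ← Real.exp_nat_mul]
      norm_num [hLdef]
    rw [hexp, ← div_eq_mul_inv, div_le_div_iff₀ (by positivity) hn0, one_mul, ← pow_succ]
    exact pow_le_pow_right₀ hn1 (by norm_num)
  · refine Eventually.of_forall fun n => ?_
    have hp1' : p n ≤ 1 := by linarith [hp1 n]
    rw [erdosRenyiMeasure_apply (hp0 n) hp1', ← ENNReal.ofReal_one]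
    refine ENNReal.ofReal_le_ofReal ?_
    refine (bernExp_mono (hp0 n) hp1' fun f => ?_).trans_eq (bernExp_one (p n))
    split_ifs <;> norm_num
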